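/- arXiv:2012.01343 — 7 statements merged into one kernel-verified Lean document; each statement's English description precedes it below -/
import Mathlib

section
/- Let a₀, a₁, a₂, b₀, b₁, b₂ ∈ ℂ with Re(a₂) > |Im(b₂)|. Then there exists R ∈ ℝ such that for every λ ∈ ℂ with Re(λ) > R there exist ν₁, ν₂, ν₃, ν₄ ∈ ℂ with Re(ν₁) > 0, Re(ν₂) > 0, Re(ν₃) < 0, Re(ν₄) < 0 and 𝒟(λ,ν) = (a₂² + b₂²)·(ν − ν₁)(ν − ν₂)(ν − ν₃)(ν − ν₄) for all ν ∈ ℂ. In particular, for Re(λ) sufficiently large the quartic ν ↦ 𝒟(λ,ν) has exactly two roots (counted with multiplicity) in each open half-plane and none on the imaginary axis, i.e., the Morse index is i_∞ = 2. -/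
/-- A quadratic `c ν² + d ν + e - l` with `Re c > 0` has exactly one root in each open half-plane
once `Re l` is large enough. -/
theorem exists_roots_of_re_pos (c d e : ℂ) (hc : 0 < c.re) :
    ∃ R : ℝ, ∀ l : ℂ, R < l.re →
      ∃ x y : ℂ, 0 < x.re ∧ y.re < 0 ∧
        ∀ ν : ℂ, c * ν ^ 2 + d * ν + e - l = c * (ν - x) * (ν - y) := by
  have hc0 : c ≠ 0 := fun h => by simp [h] at hc
  set m : ℂ := d / (2 * c) with hm
  have hd : d = 2 * c * m := by rw [hm]; field_simp
  refine ⟨(e - c * m ^ 2).re + (c.re ^ 2 + c.im ^ 2) / c.re * m.re ^ 2, fun l hl => ?_⟩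
  obtain ⟨w, hw⟩ := IsAlgClosed.exists_pow_nat_eq ((l - e + c * m ^ 2) / c) (n := 2) (by norm_num)
  have hcw : c * w ^ 2 = l - e + c * m ^ 2 := by rw [hw]; field_simp
  have hsq : m.re ^ 2 < w.re ^ 2 := by
    have hre : (c * w ^ 2).re = c.re * (w.re ^ 2 - w.im ^ 2) - c.im * (2 * w.re * w.im) := by
      simp only [pow_two, Complex.mul_re, Complex.mul_im]; ring
    have hlt : (c.re ^ 2 + c.im ^ 2) / c.re * m.re ^ 2 < (c * w ^ 2).re := by
      rw [hcw, Complex.add_re, Complex.sub_re]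
      rw [Complex.sub_re] at hl
      linarith
    rw [hre, div_mul_eq_mul_div, div_lt_iff₀ hc] at hlt
    have hpos : 0 < c.re ^ 2 + c.im ^ 2 := by positivity
    refine lt_of_mul_lt_mul_left ?_ hpos.le
    nlinarith [sq_nonneg (c.re * w.im + c.im * w.re)]
  have habs := abs_lt.mp (sq_lt_sq.mp hsq)
  have hfac (ν : ℂ) : c * ν ^ 2 + d * ν + e - l = c * (ν - (-m + w)) * (ν - (-m - w)) := by
    rw [hd]; linear_combination hcw
  rcases le_total 0 w.re with h | h
  · rw [abs_of_nonneg h] at habs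
    refine ⟨-m + w, -m - w, ?_, ?_, hfac⟩ <;> simp only [Complex.add_re, Complex.sub_re,
      Complex.neg_re] <;> linarith
  · rw [abs_of_nonpos h] at habs
    refine ⟨-m - w, -m + w, ?_, ?_, fun ν => (hfac ν).trans (by ring)⟩ <;>
      simp only [Complex.add_re, Complex.sub_re, Complex.neg_re] <;> linarith

/-- For `Re a₂ > |Im b₂|`, there is `R ∈ ℝ` such that for every `λ`
with `Re λ > R` the quartic `ν ↦ 𝒟(λ,ν)` factors with two roots of positive real
part and two roots of negative real part (Morse index `i_∞ = 2`). -/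
theorem stmt1 (a₀ a₁ a₂ b₀ b₁ b₂ : ℂ) (hell : a₂.re > |b₂.im|) :
    ∃ R : ℝ, ∀ l : ℂ, R < l.re →
      ∃ ν₁ ν₂ ν₃ ν₄ : ℂ,
        0 < ν₁.re ∧ 0 < ν₂.re ∧ ν₃.re < 0 ∧ ν₄.re < 0 ∧
        ∀ ν : ℂ,
          (a₂ * ν ^ 2 + a₁ * ν + a₀ - l) ^ 2 + (b₂ * ν ^ 2 + b₁ * ν + b₀) ^ 2
            = (a₂ ^ 2 + b₂ ^ 2) * (ν - ν₁) * (ν - ν₂) * (ν - ν₃) * (ν - ν₄) := by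
  obtain ⟨hneg, hlt⟩ := abs_lt.mp hell
  obtain ⟨R, hR⟩ := exists_roots_of_re_pos (a₂ + Complex.I * b₂) (a₁ + Complex.I * b₁)
    (a₀ + Complex.I * b₀) (by simp; linarith)
  obtain ⟨S, hS⟩ := exists_roots_of_re_pos (a₂ - Complex.I * b₂) (a₁ - Complex.I * b₁)
    (a₀ - Complex.I * b₀) (by simp; linarith)
  refine ⟨max R S, fun l hl => ?_⟩
  obtain ⟨x, y, hx, hy, hxy⟩ := hR l ((le_max_left R S).trans_lt hl)
  obtain ⟨z, t, hz, ht, hzt⟩ := hS l ((le_max_right R S).trans_lt hl)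
  refine ⟨x, z, y, t, hx, hz, hy, ht, fun ν => ?_⟩
  have hI := Complex.I_sq
  calc
    _ = ((a₂ + Complex.I * b₂) * ν ^ 2 + (a₁ + Complex.I * b₁) * ν + (a₀ + Complex.I * b₀) - l) *
        ((a₂ - Complex.I * b₂) * ν ^ 2 + (a₁ - Complex.I * b₁) * ν + (a₀ - Complex.I * b₀) - l) := by
      linear_combination (b₂ * ν ^ 2 + b₁ * ν + b₀) ^ 2 * hI
    _ = _ := by
      rw [hxy, hzt]
      linear_combination -b₂ ^ 2 * (ν - x) * (ν - y) * (ν - z) * (ν - t) * hI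
end

section
/- Let a₀, a₁, a₂, b₀, b₁, b₂ ∈ ℂ with Re(a₂) > |Im(b₂)|. Then the double root (λ⁺, ν⁺) = (−c₁²/(4c₂) + c₀, −c₁/(2c₂)) of the dispersion relation 𝒟 is pinched: there exist continuous curves Λ : [0,∞) → ℂ and ν₊, ν₋ : [0,∞) → ℂ with Λ(0) = λ⁺, ν₊(0) = ν₋(0) = ν⁺, 𝒟(Λ(τ), ν₊(τ)) = 𝒟(Λ(τ), ν₋(τ)) = 0 for all τ ≥ 0, Re(Λ(τ)) → +∞, Re(ν₊(τ)) → +∞ and Re(ν₋(τ)) → −∞ as τ → ∞. The analogous statement holds for (λ⁻, ν⁻) = (−c̃₁²/(4c̃₂) + c̃₀, −c̃₁/(2c̃₂)). -/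
/-- The dispersion relation `𝒟(λ,ν) = (a₂ν² + a₁ν + a₀ − λ)² + (b₂ν² + b₁ν + b₀)²`. -/
noncomputable def dispersion (a₀ a₁ a₂ b₀ b₁ b₂ : ℂ) (l ν : ℂ) : ℂ :=
  (a₂ * ν ^ 2 + a₁ * ν + a₀ - l) ^ 2 + (b₂ * ν ^ 2 + b₁ * ν + b₀) ^ 2

/-- A double root `(λ,ν)` of the dispersion relation is *pinched* if there exist
continuous curves `Λ, ν₊, ν₋ : [0,∞) → ℂ` with `Λ(0) = λ`, `ν₊(0) = ν₋(0) = ν`,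
`𝒟(Λ(τ), ν₊(τ)) = 𝒟(Λ(τ), ν₋(τ)) = 0` for all `τ ≥ 0`, `Re Λ(τ) → +∞`,
`Re ν₊(τ) → +∞` and `Re ν₋(τ) → −∞` as `τ → ∞`. -/
def IsPinched (a₀ a₁ a₂ b₀ b₁ b₂ : ℂ) (lam nu : ℂ) : Prop :=
  ∃ Λ νp νm : ℝ → ℂ,
    ContinuousOn Λ (Set.Ici 0) ∧ ContinuousOn νp (Set.Ici 0) ∧
    ContinuousOn νm (Set.Ici 0) ∧
    Λ 0 = lam ∧ νp 0 = nu ∧ νm 0 = nu ∧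
    (∀ τ : ℝ, 0 ≤ τ → dispersion a₀ a₁ a₂ b₀ b₁ b₂ (Λ τ) (νp τ) = 0) ∧
    (∀ τ : ℝ, 0 ≤ τ → dispersion a₀ a₁ a₂ b₀ b₁ b₂ (Λ τ) (νm τ) = 0) ∧
    Filter.Tendsto (fun τ => (Λ τ).re) Filter.atTop Filter.atTop ∧
    Filter.Tendsto (fun τ => (νp τ).re) Filter.atTop Filter.atTop ∧
    Filter.Tendsto (fun τ => (νm τ).re) Filter.atTop Filter.atBot

/-- If every zero of `c₂ν² + c₁ν + c₀ − λ`, where `Re c₂ > 0`, is a zero of the dispersion relation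
`𝒟`, then the double root of this quadratic is pinched, as the straight lines
`ν ± τ` with `Λ = λ + c₂τ²` show. -/
theorem isPinched_of_factor {a₀ a₁ a₂ b₀ b₁ b₂ c₀ c₁ c₂ : ℂ} (hc : 0 < c₂.re)
    (hfac : ∀ l ν, c₂ * ν ^ 2 + c₁ * ν + c₀ - l = 0 → dispersion a₀ a₁ a₂ b₀ b₁ b₂ l ν = 0) :
    IsPinched a₀ a₁ a₂ b₀ b₁ b₂ (-c₁ ^ 2 / (4 * c₂) + c₀) (-c₁ / (2 * c₂)) := by
  have hne : c₂ ≠ 0 := by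
    rintro rfl
    simp at hc
  refine ⟨fun τ => -c₁ ^ 2 / (4 * c₂) + c₀ + c₂ * ((τ ^ 2 : ℝ) : ℂ),
    fun τ => -c₁ / (2 * c₂) + (τ : ℂ), fun τ => -c₁ / (2 * c₂) - (τ : ℂ),
    by fun_prop, by fun_prop, by fun_prop, by simp, by simp, by simp, ?_, ?_, ?_, ?_, ?_⟩
  · intro τ _
    apply hfac
    push_cast
    field_simp
    ring
  · intro τ _
    apply hfac
    push_cast
    field_simp
    ring
  · simp only [Complex.add_re _ (c₂ * _), Complex.re_mul_ofReal]
    exact Filter.tendsto_atTop_add_const_left _ _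
      ((Filter.tendsto_pow_atTop two_ne_zero).const_mul_atTop hc)
  · simp only [Complex.add_re, Complex.ofReal_re]
    exact Filter.tendsto_atTop_add_const_left _ _ Filter.tendsto_id
  · simp only [sub_eq_add_neg, Complex.add_re, Complex.neg_re, Complex.ofReal_re]
    exact Filter.tendsto_atBot_add_const_left _ _ Filter.tendsto_neg_atTop_atBot

/-- Under the ellipticity hypothesis `Re a₂ > |Im b₂|`, the double
roots `(λ⁺,ν⁺) = (−c₁²/(4c₂) + c₀, −c₁/(2c₂))` and `(λ⁻,ν⁻) = (−c̃₁²/(4c̃₂) + c̃₀,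
−c̃₁/(2c̃₂))` of the dispersion relation are pinched. -/
theorem stmt5 (a₀ a₁ a₂ b₀ b₁ b₂ : ℂ) (hell : a₂.re > |b₂.im|) :
    IsPinched a₀ a₁ a₂ b₀ b₁ b₂
      (-(a₁ + Complex.I * b₁) ^ 2 / (4 * (a₂ + Complex.I * b₂)) + (a₀ + Complex.I * b₀))
      (-(a₁ + Complex.I * b₁) / (2 * (a₂ + Complex.I * b₂))) ∧
    IsPinched a₀ a₁ a₂ b₀ b₁ b₂
      (-(a₁ - Complex.I * b₁) ^ 2 / (4 * (a₂ - Complex.I * b₂)) + (a₀ - Complex.I * b₀))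
      (-(a₁ - Complex.I * b₁) / (2 * (a₂ - Complex.I * b₂))) := by
  obtain ⟨hneg, hpos⟩ := abs_lt.mp hell
  refine ⟨isPinched_of_factor ?_ fun l ν h => ?_, isPinched_of_factor ?_ fun l ν h => ?_⟩
  · simpa using hpos
  · unfold dispersion
    linear_combination
      (a₂ * ν ^ 2 + a₁ * ν + a₀ - l - Complex.I * (b₂ * ν ^ 2 + b₁ * ν + b₀)) * h +
      (b₂ * ν ^ 2 + b₁ * ν + b₀) ^ 2 * Complex.I_sq
  · simp
    linarith
  · unfold dispersion
    linear_combination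
      (a₂ * ν ^ 2 + a₁ * ν + a₀ - l + Complex.I * (b₂ * ν ^ 2 + b₁ * ν + b₀)) * h +
      (b₂ * ν ^ 2 + b₁ * ν + b₀) ^ 2 * Complex.I_sq
end

section
/- Let α > 0, β ≥ 0, μ, h, s, Ω ∈ ℝ, c_cp ∈ (−1,1) and β⁻ = β/(1−c_cp). The absolute spectrum of the dispersion relation d⁻ of the linearization about −e₃ equals the union of the two straight half-lines { −((α+i)/(1+α²))·k − ((α−i)/4)·s² + (α(h+μ)−β⁻)/(1+α²) + i·((h+μ+αβ⁻)/(1+α²) − Ω) : k ∈ [0,∞) } ∪ { −((α−i)/(1+α²))·k − ((α+i)/4)·s² + (α(h+μ)−β⁻)/(1+α²) − i·((h+μ+αβ⁻)/(1+α²) − Ω) : k ∈ [0,∞) }. -/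
/-- The dispersion relation `d⁻` of the linearization of the axially symmetric LLGS
equation about the down-magnetization state `−e₃`, in a frame moving with speed `s`
and rotating with frequency `Ω`, with `β⁻ = β/(1−c_cp)`. -/
noncomputable def dMinus (α β ccp μ h s Ω : ℝ) (l ν : ℂ) : ℂ :=
  (((α / (1 + α ^ 2) : ℝ) : ℂ) * ν ^ 2 + (s : ℂ) * ν
      + (((α * (h + μ) - β / (1 - ccp)) / (1 + α ^ 2) : ℝ) : ℂ) - l) ^ 2 +
  (((1 / (1 + α ^ 2) : ℝ) : ℂ) * ν ^ 2
      + (((h + μ + α * (β / (1 - ccp))) / (1 + α ^ 2) - Ω : ℝ) : ℂ)) ^ 2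

/-- A product of four linear factors with nonzero leading coefficient determines the multiset of
its roots. -/
lemma multiset_eq_of_forall_prod_sub_eq {c x₁ x₂ x₃ x₄ y₁ y₂ y₃ y₄ : ℂ} (hc : c ≠ 0)
    (H : ∀ ν : ℂ, c * (ν - x₁) * (ν - x₂) * (ν - x₃) * (ν - x₄)
      = c * (ν - y₁) * (ν - y₂) * (ν - y₃) * (ν - y₄)) :
    ({x₁, x₂, x₃, x₄} : Multiset ℂ) = {y₁, y₂, y₃, y₄} := by
  have hp : (({x₁, x₂, x₃, x₄} : Multiset ℂ).map fun a => Polynomial.X - Polynomial.C a).prod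
      = (({y₁, y₂, y₃, y₄} : Multiset ℂ).map fun a => Polynomial.X - Polynomial.C a).prod := by
    refine Polynomial.funext fun ν => ?_
    have := H ν
    simp only [mul_assoc] at this
    simpa using mul_left_cancel₀ hc this
  rw [← Polynomial.roots_multiset_prod_X_sub_C ({x₁, x₂, x₃, x₄} : Multiset ℂ), hp,
    Polynomial.roots_multiset_prod_X_sub_C]

/-- If four reals in descending order are `m ± a`, `m ± b` with `0 ≤ a ≤ b` and the middle two
coincide, then `a = 0`. -/
lemma eq_zero_of_multiset_eq {m a b r₁ r₂ r₃ r₄ : ℝ} (ha : 0 ≤ a) (hab : a ≤ b)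
    (h₁₂ : r₂ ≤ r₁) (h₃₄ : r₄ ≤ r₃) (h : r₂ = r₃)
    (H : ({m + b, m + a, m - a, m - b} : Multiset ℝ) = {r₁, r₂, r₃, r₄}) : a = 0 := by
  have hperm : [m + b, m + a, m - a, m - b].Perm [r₁, r₂, r₃, r₄] := Multiset.coe_eq_coe.1 H
  have hl : [m + b, m + a, m - a, m - b].Pairwise (· ≥ ·) := by
    simp; refine ⟨⟨?_, ?_, ?_⟩, ⟨?_, ?_⟩, ?_⟩ <;> linarith
  have hr : [r₁, r₂, r₃, r₄].Pairwise (· ≥ ·) := by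
    simp; refine ⟨⟨?_, ?_, ?_⟩, ⟨?_, ?_⟩, ?_⟩ <;> linarith
  have := hperm.eq_of_pairwise (fun x y _ _ hxy hyx => le_antisymm hyx hxy) hl hr
  simp only [List.cons.injEq] at this
  linarith [this.2.1, this.2.2.1]

/-- A quartic with roots `m₁ ± z`, `m₂ ± w`, where `Re m₁ = Re m₂`, has its two middle roots on a
common vertical line iff `z` or `w` is purely imaginary. -/
lemma exists_ordered_roots_iff {c m₁ m₂ z w : ℂ} (hc : c ≠ 0) (hm : m₁.re = m₂.re)
    (hz : 0 ≤ z.re) (hw : 0 ≤ w.re) {f : ℂ → ℂ}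
    (hf : ∀ ν, f ν = c * (ν - (m₁ + z)) * (ν - (m₁ - z)) * (ν - (m₂ + w)) * (ν - (m₂ - w))) :
    (∃ ν₁ ν₂ ν₃ ν₄ : ℂ,
        ν₂.re ≤ ν₁.re ∧ ν₃.re ≤ ν₂.re ∧ ν₄.re ≤ ν₃.re ∧ ν₂.re = ν₃.re ∧
        ∀ ν : ℂ, f ν = c * (ν - ν₁) * (ν - ν₂) * (ν - ν₃) * (ν - ν₄))
      ↔ z.re = 0 ∨ w.re = 0 := by
  constructor
  · rintro ⟨ν₁, ν₂, ν₃, ν₄, h₁₂, -, h₃₄, h, H⟩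
    rcases le_total z.re w.re with hzw | hzw
    · left
      have hH := multiset_eq_of_forall_prod_sub_eq (x₁ := m₂ + w) (x₂ := m₁ + z) (x₃ := m₁ - z)
        (x₄ := m₂ - w) hc fun ν => by rw [← H, hf]; ring
      have hre := congrArg (Multiset.map Complex.re) hH
      exact eq_zero_of_multiset_eq (m := m₁.re) hz hzw h₁₂ h₃₄ h (by simpa [hm] using hre)
    · right
      have hH := multiset_eq_of_forall_prod_sub_eq (x₁ := m₁ + z) (x₂ := m₂ + w) (x₃ := m₂ - w)
        (x₄ := m₁ - z) hc fun ν => by rw [← H, hf]; ring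
      have hre := congrArg (Multiset.map Complex.re) hH
      exact eq_zero_of_multiset_eq (m := m₁.re) hw hzw h₁₂ h₃₄ h (by simpa [hm] using hre)
  · rintro (h | h)
    · refine ⟨m₂ + w, m₁ + z, m₁ - z, m₂ - w, ?_, ?_, ?_, ?_, fun ν => by rw [hf]; ring⟩ <;>
        simp only [Complex.add_re, Complex.sub_re] <;> linarith
    · refine ⟨m₁ + z, m₂ + w, m₂ - w, m₁ - z, ?_, ?_, ?_, ?_, fun ν => by rw [hf]; ring⟩ <;>
        simp only [Complex.add_re, Complex.sub_re] <;> linarith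

/-- A complex number is purely imaginary iff its square is a nonpositive real. -/
lemma re_eq_zero_iff_exists_sq_eq_neg (z : ℂ) :
    z.re = 0 ↔ ∃ k : ℝ, 0 ≤ k ∧ z ^ 2 = -(k : ℂ) := by
  constructor
  · intro h
    refine ⟨z.im ^ 2, sq_nonneg _, ?_⟩
    apply Complex.ext <;> simp [pow_two, h]
  · rintro ⟨k, hk, h⟩
    have h1 := congrArg Complex.re h
    have h2 := congrArg Complex.im h
    simp [pow_two] at h1 h2
    by_contra h0
    have h3 : z.im = 0 := by
      have : z.re * z.im = 0 := by linarith
      exact (mul_eq_zero.1 this).resolve_left h0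
    rw [h3] at h1
    have := mul_self_pos.2 h0
    linarith

/-- Every complex number has a square root with nonnegative real part. -/
lemma exists_sq_eq_and_re_nonneg (p : ℂ) : ∃ z : ℂ, z ^ 2 = p ∧ 0 ≤ z.re := by
  obtain ⟨z, hz⟩ := IsAlgClosed.exists_pow_nat_eq p two_pos
  rcases le_total 0 z.re with h | h
  · exact ⟨z, hz, h⟩
  · exact ⟨-z, by rw [neg_sq, hz], by simpa using h⟩

/-- The absolute spectrum of `d⁻` — the set of `λ` whose four spatial
roots (with multiplicity, ordered by descending real part) satisfy `Re ν₂ = Re ν₃` —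
equals the union of the two straight half-lines stated in Corollary 4.6 of the paper. -/
theorem stmt10 (α β ccp μ h s Ω : ℝ) (hα : 0 < α) (hβ : 0 ≤ β)
    (hc1 : -1 < ccp) (hc2 : ccp < 1) :
    {l : ℂ | ∃ ν₁ ν₂ ν₃ ν₄ : ℂ,
        ν₂.re ≤ ν₁.re ∧ ν₃.re ≤ ν₂.re ∧ ν₄.re ≤ ν₃.re ∧ ν₂.re = ν₃.re ∧
        ∀ ν : ℂ, dMinus α β ccp μ h s Ω l ν
          = ((1 / (1 + α ^ 2) : ℝ) : ℂ) * (ν - ν₁) * (ν - ν₂) * (ν - ν₃) * (ν - ν₄)}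
    = {l : ℂ | ∃ k : ℝ, 0 ≤ k ∧
          l = -(((α : ℂ) + Complex.I) / (1 + (α : ℂ) ^ 2)) * (k : ℂ)
              - (((α : ℂ) - Complex.I) / 4) * (s : ℂ) ^ 2
              + (((α * (h + μ) - β / (1 - ccp)) / (1 + α ^ 2) : ℝ) : ℂ)
              + Complex.I * (((h + μ + α * (β / (1 - ccp))) / (1 + α ^ 2) - Ω : ℝ) : ℂ)}
      ∪ {l : ℂ | ∃ k : ℝ, 0 ≤ k ∧
          l = -(((α : ℂ) - Complex.I) / (1 + (α : ℂ) ^ 2)) * (k : ℂ)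
              - (((α : ℂ) + Complex.I) / 4) * (s : ℂ) ^ 2
              + (((α * (h + μ) - β / (1 - ccp)) / (1 + α ^ 2) : ℝ) : ℂ)
              - Complex.I * (((h + μ + α * (β / (1 - ccp))) / (1 + α ^ 2) - Ω : ℝ) : ℂ)} := by
  have hc : ((1 / (1 + α ^ 2) : ℝ) : ℂ) ≠ 0 := by
    exact_mod_cast (by positivity : (1 / (1 + α ^ 2) : ℝ) ≠ 0)
  have hN : (1 + (α : ℂ) ^ 2) = (α - Complex.I) * (α + Complex.I) := by
    linear_combination Complex.I_sq
  have hminus : (α : ℂ) - Complex.I ≠ 0 := fun h => by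
    simpa using congrArg Complex.im h
  have hplus : (α : ℂ) + Complex.I ≠ 0 := fun h => by
    simpa using congrArg Complex.im h
  ext l
  simp only [Set.mem_union, Set.mem_ofPred_eq]
  set C : ℝ := (α * (h + μ) - β / (1 - ccp)) / (1 + α ^ 2) with hC
  set D : ℝ := (h + μ + α * (β / (1 - ccp))) / (1 + α ^ 2) - Ω with hD
  obtain ⟨z, hz, hz0⟩ := exists_sq_eq_and_re_nonneg
    ((α - Complex.I) ^ 2 * s ^ 2 / 4 - (α - Complex.I) * (C - l + Complex.I * D))
  obtain ⟨w, hw, hw0⟩ := exists_sq_eq_and_re_nonneg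
    ((α + Complex.I) ^ 2 * s ^ 2 / 4 - (α + Complex.I) * (C - l - Complex.I * D))
  have hf : ∀ ν, dMinus α β ccp μ h s Ω l ν = ((1 / (1 + α ^ 2) : ℝ) : ℂ)
      * (ν - (-((α - Complex.I) * s / 2) + z)) * (ν - (-((α - Complex.I) * s / 2) - z))
      * (ν - (-((α + Complex.I) * s / 2) + w)) * (ν - (-((α + Complex.I) * s / 2) - w)) := by
    intro ν
    have hzfac : (ν - (-((α - Complex.I) * s / 2) + z)) * (ν - (-((α - Complex.I) * s / 2) - z))
        = ν ^ 2 + (α - Complex.I) * (s * ν + (C - l + Complex.I * D)) := by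
      linear_combination -hz
    have hwfac : (ν - (-((α + Complex.I) * s / 2) + w)) * (ν - (-((α + Complex.I) * s / 2) - w))
        = ν ^ 2 + (α + Complex.I) * (s * ν + (C - l - Complex.I * D)) := by
      linear_combination -hw
    rw [mul_assoc _ (ν - (-((α + Complex.I) * s / 2) + w)), hwfac,
      mul_assoc _ (ν - (-((α - Complex.I) * s / 2) + z)), hzfac, dMinus, ← hC, ← hD]
    push_cast
    have hp : (α : ℂ) / (1 + α ^ 2) * ν ^ 2 + s * ν + C - l
        + Complex.I * (1 / (1 + α ^ 2) * ν ^ 2 + D)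
        = (ν ^ 2 + (α - Complex.I) * (s * ν + (C - l + Complex.I * D))) / (α - Complex.I) := by
      rw [hN]; field_simp; ring
    have hm : (α : ℂ) / (1 + α ^ 2) * ν ^ 2 + s * ν + C - l
        - Complex.I * (1 / (1 + α ^ 2) * ν ^ 2 + D)
        = (ν ^ 2 + (α + Complex.I) * (s * ν + (C - l - Complex.I * D))) / (α + Complex.I) := by
      rw [hN]; field_simp; ring
    calc _ = ((α : ℂ) / (1 + α ^ 2) * ν ^ 2 + s * ν + C - l
          + Complex.I * (1 / (1 + α ^ 2) * ν ^ 2 + D))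
          * ((α : ℂ) / (1 + α ^ 2) * ν ^ 2 + s * ν + C - l
          - Complex.I * (1 / (1 + α ^ 2) * ν ^ 2 + D)) := by
          linear_combination (1 / (1 + (α : ℂ) ^ 2) * ν ^ 2 + D) ^ 2 * Complex.I_sq
      _ = _ := by rw [hp, hm, hN]; field_simp
  rw [exists_ordered_roots_iff hc (by simp) hz0 hw0 hf, re_eq_zero_iff_exists_sq_eq_neg,
    re_eq_zero_iff_exists_sq_eq_neg, hz, hw]
  refine or_congr (exists_congr fun k => and_congr_right fun _ => ?_)
    (exists_congr fun k => and_congr_right fun _ => ?_)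
  · have : ((α : ℂ) + Complex.I) / (1 + α ^ 2) = 1 / (α - Complex.I) := by
      rw [hN]; field_simp
    have key : (α - Complex.I) * (l - (-(1 / ((α : ℂ) - Complex.I)) * k
        - (α - Complex.I) / 4 * s ^ 2 + C + Complex.I * D))
        = (α - Complex.I) ^ 2 * s ^ 2 / 4 - (α - Complex.I) * (C - l + Complex.I * D)
          - -(k : ℂ) := by
      field_simp; ring
    rw [this, ← sub_eq_zero, ← sub_eq_zero (a := l), ← key, mul_eq_zero_iff_left hminus]
  · have : ((α : ℂ) - Complex.I) / (1 + α ^ 2) = 1 / (α + Complex.I) := by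
      rw [hN]; field_simp
    have key : (α + Complex.I) * (l - (-(1 / ((α : ℂ) + Complex.I)) * k
        - (α + Complex.I) / 4 * s ^ 2 + C - Complex.I * D))
        = (α + Complex.I) ^ 2 * s ^ 2 / 4 - (α + Complex.I) * (C - l - Complex.I * D)
          - -(k : ℂ) := by
      field_simp; ring
    rw [this, ← sub_eq_zero, ← sub_eq_zero (a := l), ← key, mul_eq_zero_iff_left hplus]
end

section
/- Let α > 0, β ≥ 0, μ, h, s, Ω ∈ ℝ, c_cp ∈ (−1,1) and β⁻ = β/(1−c_cp). Define λ_dr^± = −αs²/4 ± i·s²/4 + (α(h+μ)−β⁻)/(1+α²) ± i·((h+μ+αβ⁻)/(1+α²) − Ω) and ν_dr^± = −αs/2 ± i·s/2. Then (λ_dr^+, ν_dr^+) and (λ_dr^−, ν_dr^−) are double roots of the dispersion relation d⁻, i.e., d⁻(λ_dr^±, ν_dr^±) = 0 and ∂_ν d⁻(λ_dr^±, ν_dr^±) = 0; they are the rightmost points of the absolute spectrum of d⁻. -/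
/-- The absolute spectrum of `d⁻`: the set of `λ` whose four spatial roots (with
multiplicity, ordered by descending real part) satisfy `Re ν₂ = Re ν₃`. -/
def absSpecDMinus (α β ccp μ h s Ω : ℝ) : Set ℂ :=
  {l : ℂ | ∃ ν₁ ν₂ ν₃ ν₄ : ℂ,
      ν₂.re ≤ ν₁.re ∧ ν₃.re ≤ ν₂.re ∧ ν₄.re ≤ ν₃.re ∧ ν₂.re = ν₃.re ∧
      ∀ ν : ℂ, dMinus α β ccp μ h s Ω l ν
        = ((1 / (1 + α ^ 2) : ℝ) : ℂ) * (ν - ν₁) * (ν - ν₂) * (ν - ν₃) * (ν - ν₄)}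

/-- The double roots
`λ_dr^± = −αs²/4 ± i s²/4 + (α(h+μ)−β⁻)/(1+α²) ± i((h+μ+αβ⁻)/(1+α²) − Ω)`. -/
noncomputable def lamDR (α β ccp μ h s Ω : ℝ) (σ : ℝ) : ℂ :=
  ((-α * s ^ 2 / 4 + (α * (h + μ) - β / (1 - ccp)) / (1 + α ^ 2) : ℝ) : ℂ)
    + Complex.I * ((σ * (s ^ 2 / 4 + (h + μ + α * (β / (1 - ccp))) / (1 + α ^ 2) - Ω) : ℝ) : ℂ)

/-- The spatial double roots `ν_dr^± = −αs/2 ± i s/2`. -/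
noncomputable def nuDR (α s : ℝ) (σ : ℝ) : ℂ :=
  ((-α * s / 2 : ℝ) : ℂ) + Complex.I * ((σ * (s / 2) : ℝ) : ℂ)

/-- `d⁻` factors into two quadratics centred at `ν_dr^σ` and `ν_dr^{-σ}`. -/
lemma dMinus_factorization (α β ccp μ h s Ω σ : ℝ) (hσ : σ ^ 2 = 1) (l ν : ℂ) :
    dMinus α β ccp μ h s Ω l ν = ((1 / (1 + α ^ 2) : ℝ) : ℂ) *
      ((ν - nuDR α s σ) ^ 2 - (α - σ * Complex.I) * (l - lamDR α β ccp μ h s Ω σ)) *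
      ((ν - nuDR α s (-σ)) ^ 2 - (α + σ * Complex.I) * (l - lamDR α β ccp μ h s Ω (-σ))) := by
  have hk : (1 + (α : ℂ) ^ 2) ≠ 0 := by
    have : (1 + α ^ 2 : ℝ) ≠ 0 := by positivity
    exact_mod_cast this
  have hσ' : (σ : ℂ) ^ 2 = 1 := by exact_mod_cast hσ
  have hI := Complex.I_sq
  unfold dMinus lamDR nuDR
  generalize β / (1 - ccp) = b
  push_cast
  generalize hK : (1 + (α : ℂ) ^ 2)⁻¹ = K
  have hK1 : K * (1 + (α : ℂ) ^ 2) = 1 := by rw [← hK]; exact inv_mul_cancel₀ hk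
  simp only [div_eq_mul_inv, hK, one_mul]
  generalize hJ : (σ : ℂ) * Complex.I = J
  have hJ2 : J ^ 2 = -1 := by rw [← hJ, mul_pow, hσ', hI]; ring
  have e (x : ℂ) : Complex.I * (σ * x) = J * x := by rw [← hJ]; ring
  have e' (x : ℂ) : Complex.I * (-σ * x) = -(J * x) := by rw [← hJ]; ring
  simp only [e, e']
  generalize hA : (α * (h + μ) - b) * K = A
  generalize hB : (h + μ + α * b) * K = B
  have quad (j : ℂ) (hj : j ^ 2 = -1) :
      (α * K * ν ^ 2 + s * ν + A - l) + j * (K * ν ^ 2 + (B - Ω)) = (α + j) * K *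
        ((ν - (-α * s * 2⁻¹ + j * (s * 2⁻¹))) ^ 2 - (α - j) *
          (l - (-α * s ^ 2 * 4⁻¹ + A + j * (s ^ 2 * 4⁻¹ + B - Ω)))) := by
    have h1 : (α + j) * (α - j) * K = 1 := by linear_combination hK1 - K * hj
    linear_combination (-s * ν + l - A - j * (B - Ω) + α * s ^ 2 / 4 - j * s ^ 2 / 4
      - (α - j) * s ^ 2 / 4) * h1
  have q1 := quad J hJ2
  have q2 := quad (-J) (by rw [neg_sq, hJ2])
  have h1 : (α + J) * (α - J) * K = 1 := by linear_combination hK1 - K * hJ2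
  have split_sq (P Q X Y : ℂ) (hX : P + J * Q = (α + J) * K * X)
      (hY : P + -J * Q = (α + -J) * K * Y) : P ^ 2 + Q ^ 2 = K * X * Y := by
    linear_combination (P - J * Q) * hX + (α + J) * K * X * hY + K * X * Y * h1 + Q ^ 2 * hJ2
  refine split_sq _ _ _ _ (q1.trans ?_) (q2.trans ?_) <;> ring

lemma nuDR_re (α s σ : ℝ) : (nuDR α s σ).re = -α * s / 2 := by
  simp [nuDR, -Complex.ofReal_mul, -Complex.ofReal_div, -Complex.ofReal_neg]

lemma lamDR_re (α β ccp μ h s Ω σ : ℝ) : (lamDR α β ccp μ h s Ω σ).re =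
    -α * s ^ 2 / 4 + (α * (h + μ) - β / (1 - ccp)) / (1 + α ^ 2) := by
  rw [lamDR, Complex.add_re, Complex.ofReal_re, Complex.re_mul_ofReal]
  simp

/-- If two centrally symmetric pairs about the vertical line `Re = c` are listed by
descending real part and the two middle real parts agree, they lie on that line. -/
lemma re_eq_of_middle_re_eq {c : ℝ} {ν₁ ν₂ ν₃ ν₄ p₁ p₂ q₁ q₂ k : ℂ} (hk : k ≠ 0)
    (hp : p₁.re + p₂.re = 2 * c) (hq : q₁.re + q₂.re = 2 * c)
    (h12 : ν₂.re ≤ ν₁.re) (h34 : ν₄.re ≤ ν₃.re) (h23 : ν₂.re = ν₃.re)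
    (H : ∀ ν : ℂ, k * (ν - p₁) * (ν - p₂) * (ν - q₁) * (ν - q₂) =
      k * (ν - ν₁) * (ν - ν₂) * (ν - ν₃) * (ν - ν₄)) : ν₂.re = c := by
  classical
  have hm : ({p₁, p₂, q₁, q₂} : Multiset ℂ) = {ν₁, ν₂, ν₃, ν₄} := by
    rw [← Polynomial.roots_multiset_prod_X_sub_C {p₁, p₂, q₁, q₂},
      ← Polynomial.roots_multiset_prod_X_sub_C {ν₁, ν₂, ν₃, ν₄}]
    congr 1
    refine Polynomial.funext fun ν => mul_left_cancel₀ hk ?_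
    simpa [mul_assoc] using H ν
  rcases lt_trichotomy ν₂.re c with hlt | heq | hgt
  · have := congrArg (Multiset.countP fun z : ℂ => c ≤ z.re) hm
    simp only [Multiset.insert_eq_cons, ← Multiset.cons_zero, Multiset.countP_cons,
      Multiset.countP_zero] at this
    rw [if_neg (by linarith : ¬ c ≤ ν₂.re), if_neg (by linarith : ¬ c ≤ ν₃.re),
      if_neg (by linarith : ¬ c ≤ ν₄.re)] at this
    split_ifs at this <;> first | omega | (exfalso; linarith)
  · exact heq
  · have := congrArg (Multiset.countP fun z : ℂ => z.re ≤ c) hm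
    simp only [Multiset.insert_eq_cons, ← Multiset.cons_zero, Multiset.countP_cons,
      Multiset.countP_zero] at this
    rw [if_neg (by linarith : ¬ ν₁.re ≤ c), if_neg (by linarith : ¬ ν₂.re ≤ c),
      if_neg (by linarith : ¬ ν₃.re ≤ c)] at this
    split_ifs at this <;> first | omega | (exfalso; linarith)

lemma re_nonpos_of_sq_eq {α σ : ℝ} (hα : 0 < α) (hσ : σ ^ 2 = 1) {w z : ℂ} (hw : w.re = 0)
    (h : w ^ 2 = (α - σ * Complex.I) * z) : z.re ≤ 0 := by
  have hre := congrArg Complex.re h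
  have him := congrArg Complex.im h
  simp [pow_two, hw] at hre him
  have hx : (1 + α ^ 2) * z.re = -(α * w.im ^ 2) := by
    linear_combination -α * hre + σ * him - z.re * hσ
  by_contra! hz
  nlinarith [mul_pos (by positivity : 0 < 1 + α ^ 2) hz, mul_nonneg hα.le (sq_nonneg w.im)]

lemma lamDR_mem_absSpecDMinus (α β ccp μ h s Ω σ : ℝ) (hσ : σ ^ 2 = 1) :
    lamDR α β ccp μ h s Ω σ ∈ absSpecDMinus α β ccp μ h s Ω := by
  set l := lamDR α β ccp μ h s Ω σ with hl
  obtain ⟨w, hw, hw0⟩ : ∃ w : ℂ,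
      w ^ 2 = (α + σ * Complex.I) * (l - lamDR α β ccp μ h s Ω (-σ)) ∧ 0 ≤ w.re := by
    obtain ⟨w, hw⟩ := IsAlgClosed.exists_pow_nat_eq
      ((α + σ * Complex.I) * (l - lamDR α β ccp μ h s Ω (-σ))) two_pos
    rcases le_total 0 w.re with h0 | h0
    · exact ⟨w, hw, h0⟩
    · exact ⟨-w, by rw [neg_sq, hw], by simpa using h0⟩
  refine ⟨nuDR α s (-σ) + w, nuDR α s σ, nuDR α s σ, nuDR α s (-σ) - w, ?_, le_rfl, ?_, rfl,
    fun ν => ?_⟩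
  · simpa [nuDR_re] using hw0
  · simpa [nuDR_re] using hw0
  · rw [dMinus_factorization α β ccp μ h s Ω σ hσ, ← hw, ← hl, sub_self]
    ring

lemma re_le_of_mem_absSpecDMinus {α β ccp μ h s Ω : ℝ} (hα : 0 < α) {l : ℂ}
    (hl : l ∈ absSpecDMinus α β ccp μ h s Ω) (τ : ℝ) :
    l.re ≤ (lamDR α β ccp μ h s Ω τ).re := by
  obtain ⟨ν₁, ν₂, ν₃, ν₄, h12, -, h34, h23, H⟩ := hl
  have hk : ((1 / (1 + α ^ 2) : ℝ) : ℂ) ≠ 0 := by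
    exact_mod_cast (by positivity : (1 / (1 + α ^ 2) : ℝ) ≠ 0)
  have F := dMinus_factorization α β ccp μ h s Ω 1 (by norm_num) l
  obtain ⟨w, hw⟩ := IsAlgClosed.exists_pow_nat_eq
    ((α - (1 : ℝ) * Complex.I) * (l - lamDR α β ccp μ h s Ω 1)) two_pos
  obtain ⟨w', hw'⟩ := IsAlgClosed.exists_pow_nat_eq
    ((α + (1 : ℝ) * Complex.I) * (l - lamDR α β ccp μ h s Ω (-1))) two_pos
  have hc : ν₂.re = -α * s / 2 := by
    refine re_eq_of_middle_re_eq (p₁ := nuDR α s 1 + w) (p₂ := nuDR α s 1 - w)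
      (q₁ := nuDR α s (-1) + w') (q₂ := nuDR α s (-1) - w') hk ?_ ?_ h12 h34 h23 fun ν => ?_
    · simp only [Complex.add_re, Complex.sub_re, nuDR_re]; ring
    · simp only [Complex.add_re, Complex.sub_re, nuDR_re]; ring
    · rw [← H, F, ← hw, ← hw']; ring
  have h0 : dMinus α β ccp μ h s Ω l ν₂ = 0 := by rw [H]; ring
  rw [F, mul_assoc, mul_eq_zero, mul_eq_zero, or_iff_right hk] at h0
  have key (σ : ℝ) (hσ : σ ^ 2 = 1) (e : (ν₂ - nuDR α s σ) ^ 2 =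
      (α - σ * Complex.I) * (l - lamDR α β ccp μ h s Ω σ)) :
      l.re ≤ (lamDR α β ccp μ h s Ω τ).re := by
    have := re_nonpos_of_sq_eq hα hσ (by rw [Complex.sub_re, nuDR_re, hc, sub_self]) e
    rw [Complex.sub_re, lamDR_re] at this
    rw [lamDR_re]
    linarith
  rcases h0 with h0 | h0
  · exact key 1 (by norm_num) (sub_eq_zero.mp h0)
  · refine key (-1) (by norm_num) ((sub_eq_zero.mp h0).trans ?_)
    push_cast
    ring

lemma deriv_dMinus_lamDR (α β ccp μ h s Ω σ : ℝ) (hσ : σ ^ 2 = 1) :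
    deriv (fun ν => dMinus α β ccp μ h s Ω (lamDR α β ccp μ h s Ω σ) ν) (nuDR α s σ) = 0 := by
  simp only [dMinus_factorization α β ccp μ h s Ω σ hσ, sub_self, mul_zero, sub_zero]
  rw [deriv_fun_mul (by fun_prop) (by fun_prop), deriv_const_mul _ (by fun_prop),
    deriv_fun_pow (by fun_prop)]
  simp

/-- `(λ_dr^+, ν_dr^+)` and `(λ_dr^−, ν_dr^−)` are double roots of `d⁻`
(i.e. `d⁻ = 0` and `∂_ν d⁻ = 0` there), they belong to the absolute spectrum of `d⁻`,
and they are its rightmost points. -/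
theorem stmt11 (α β ccp μ h s Ω : ℝ) (hα : 0 < α) (hβ : 0 ≤ β)
    (hc1 : -1 < ccp) (hc2 : ccp < 1) :
    (∀ σ : ℝ, σ = 1 ∨ σ = -1 →
      dMinus α β ccp μ h s Ω (lamDR α β ccp μ h s Ω σ) (nuDR α s σ) = 0 ∧
      deriv (fun ν => dMinus α β ccp μ h s Ω (lamDR α β ccp μ h s Ω σ) ν) (nuDR α s σ) = 0 ∧
      lamDR α β ccp μ h s Ω σ ∈ absSpecDMinus α β ccp μ h s Ω) ∧
    (∀ l ∈ absSpecDMinus α β ccp μ h s Ω,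
      l.re ≤ (lamDR α β ccp μ h s Ω 1).re ∧ l.re ≤ (lamDR α β ccp μ h s Ω (-1)).re) := by
  refine ⟨fun σ hσ => ?_, fun l hl =>
    ⟨re_le_of_mem_absSpecDMinus hα hl 1, re_le_of_mem_absSpecDMinus hα hl (-1)⟩⟩
  have hσ2 : σ ^ 2 = 1 := by rcases hσ with rfl | rfl <;> norm_num
  refine ⟨?_, deriv_dMinus_lamDR α β ccp μ h s Ω σ hσ2,
    lamDR_mem_absSpecDMinus α β ccp μ h s Ω σ hσ2⟩
  rw [dMinus_factorization α β ccp μ h s Ω σ hσ2]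
  simp
end

section
/- Let α > 0, β ≥ 0, μ, h, Ω ∈ ℝ, c_cp ∈ (−1,1), β⁻ = β/(1−c_cp), and let s ∈ ℝ with s ≠ 0. Then the double roots (λ_dr^±, ν_dr^±) of the dispersion relation d⁻, with λ_dr^± = −αs²/4 ± i·s²/4 + (α(h+μ)−β⁻)/(1+α²) ± i·((h+μ+αβ⁻)/(1+α²) − Ω) and ν_dr^± = −αs/2 ± i·s/2, are simple: ∂_λ d⁻(λ_dr^±, ν_dr^±) ≠ 0 and ∂²_ν d⁻(λ_dr^±, ν_dr^±) ≠ 0. -/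
/-- The derivative in `l` of a sum of two squares `(p - l)² + q²`. -/
lemma deriv_sub_sq_add_sq (p q l : ℂ) :
    deriv (fun l : ℂ => (p - l) ^ 2 + q ^ 2) l = -2 * (p - l) := by
  have h := (((hasDerivAt_id l).const_sub p).pow 2).add_const (q ^ 2)
  refine (h.congr_deriv ?_).deriv
  simp

/-- The derivative in `x` of a sum of squares of two quadratic polynomials. -/
lemma deriv_quadratic_sq_add_sq (a b s c e l x : ℂ) :
    deriv (fun x : ℂ => (a * x ^ 2 + s * x + c - l) ^ 2 + (b * x ^ 2 + e) ^ 2) x =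
      2 * (a * x ^ 2 + s * x + c - l) * (2 * a * x + s) +
        2 * (b * x ^ 2 + e) * (2 * b * x) := by
  have hx := hasDerivAt_id x
  have h := ((((((hx.pow 2).const_mul a).add (hx.const_mul s)).add_const c).sub_const l).pow 2).add
    ((((hx.pow 2).const_mul b).add_const e).pow 2)
  refine (h.congr_deriv ?_).deriv
  simp
  ring

/-- The second derivative in `x` of a sum of squares of two quadratic polynomials. -/
lemma deriv_deriv_quadratic_sq_add_sq (a b s c e l x : ℂ) :
    deriv (deriv (fun x : ℂ => (a * x ^ 2 + s * x + c - l) ^ 2 + (b * x ^ 2 + e) ^ 2)) x =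
      2 * (2 * a * x + s) ^ 2 + 4 * a * (a * x ^ 2 + s * x + c - l) +
        2 * (2 * b * x) ^ 2 + 4 * b * (b * x ^ 2 + e) := by
  rw [funext (deriv_quadratic_sq_add_sq a b s c e l)]
  have hx := hasDerivAt_id x
  have hA := ((((hx.pow 2).const_mul a).add (hx.const_mul s)).add_const c).sub_const l
  have hB := ((hx.pow 2).const_mul b).add_const e
  have h := ((hA.const_mul 2).mul ((hx.const_mul (2 * a)).add_const s)).add
    ((hB.const_mul 2).mul (hx.const_mul (2 * b)))
  refine (h.congr_deriv ?_).deriv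
  simp
  ring

/-- For `s ≠ 0`, the double roots `(λ_dr^±, ν_dr^±)` of `d⁻` are simple:
`∂_λ d⁻(λ_dr^±, ν_dr^±) ≠ 0` and `∂²_ν d⁻(λ_dr^±, ν_dr^±) ≠ 0`. -/
theorem stmt12 (α β ccp μ h s Ω : ℝ) (hα : 0 < α) (hβ : 0 ≤ β)
    (hc1 : -1 < ccp) (hc2 : ccp < 1) (hs : s ≠ 0) :
    ∀ σ : ℝ, σ = 1 ∨ σ = -1 →
      deriv (fun l => dMinus α β ccp μ h s Ω l (nuDR α s σ)) (lamDR α β ccp μ h s Ω σ) ≠ 0 ∧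
      deriv (deriv (fun ν => dMinus α β ccp μ h s Ω (lamDR α β ccp μ h s Ω σ) ν))
        (nuDR α s σ) ≠ 0 := by
  intro σ hσ
  have hσ0 : σ ≠ 0 := by rcases hσ with rfl | rfl <;> norm_num
  have hσ2 : (σ : ℂ) ^ 2 = 1 := by rcases hσ with rfl | rfl <;> norm_num
  have hI := Complex.I_sq
  simp only [dMinus]
  rw [deriv_sub_sq_add_sq, deriv_deriv_quadratic_sq_add_sq]
  have hν : nuDR α s σ = -s / 2 * (α - Complex.I * σ) := by
    simp only [nuDR]; push_cast; ring
  have hl : lamDR α β ccp μ h s Ω σ = -s ^ 2 / 4 * (α - Complex.I * σ) +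
      (((α * (h + μ) - β / (1 - ccp)) / (1 + α ^ 2) : ℝ) : ℂ) +
      Complex.I * σ * (((h + μ + α * (β / (1 - ccp))) / (1 + α ^ 2) - Ω : ℝ) : ℂ) := by
    simp only [lamDR]; push_cast; ring
  have ha : α / (1 + α ^ 2) = α * (1 / (1 + α ^ 2)) := by ring
  rw [hl, hν, ha]
  generalize (α * (h + μ) - β / (1 - ccp)) / (1 + α ^ 2) = c
  generalize (h + μ + α * (β / (1 - ccp))) / (1 + α ^ 2) - Ω = e
  have hb : 1 / (1 + α ^ 2) * (1 + α ^ 2) = 1 := by field_simp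
  have hb0 : 1 / (1 + α ^ 2) ≠ 0 := by positivity
  generalize 1 / (1 + α ^ 2) = b at hb hb0 ⊢
  have hbC : (b : ℂ) * (1 + (α : ℂ) ^ 2) = 1 := by exact_mod_cast hb
  rw [Complex.ofReal_mul α b]
  set x : ℂ := -s / 2 * (α - Complex.I * σ) with hx
  set B : ℂ := b * x ^ 2 + e with hB
  have hB0 : B ≠ 0 := by
    intro h0
    have him : B.im = -(b * s ^ 2 * α * σ / 2) := by
      have : B = ((b * s ^ 2 / 4 * (α ^ 2 - σ ^ 2) + e : ℝ) : ℂ) +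
          ((-(b * s ^ 2 * α * σ / 2) : ℝ) : ℂ) * Complex.I := by
        rw [hB, hx]; push_cast
        linear_combination (b * s ^ 2 / 4 * σ ^ 2 : ℂ) * hI
      rw [this, Complex.add_im, Complex.ofReal_im, Complex.im_ofReal_mul, Complex.I_im]
      ring
    rw [h0, Complex.zero_im] at him
    have : b * s ^ 2 * α * σ / 2 ≠ 0 := by positivity
    exact this (by linarith)
  have hIσ : (Complex.I * σ) ^ 2 = -1 := by rw [mul_pow, hI, hσ2]; ring
  have hIσ0 : Complex.I * (σ : ℂ) ≠ 0 := by
    intro h0; rw [h0] at hIσ; norm_num at hIσ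
  clear_value B x
  generalize Complex.I * (σ : ℂ) = j at *
  have hs' : 2 * ((α : ℂ) * b) * x + s = -(2 * j * b * x) := by
    rw [hx]
    linear_combination (-s : ℂ) * hbC + (s * b : ℂ) * hIσ
  have hA : (α : ℂ) * b * x ^ 2 + s * x + c - (-s ^ 2 / 4 * (α - j) + c + j * e) = -(j * B) := by
    rw [hB]
    linear_combination (x / 2) * hs' + (s / 2 : ℂ) * hx
  rw [hA, hs']
  refine ⟨?_, ?_⟩
  · simpa using ⟨hIσ0, hB0⟩
  · have hE : 2 * (-(2 * j * b * x)) ^ 2 + 4 * ((α : ℂ) * b) * -(j * B) + 2 * (2 * b * x) ^ 2 +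
        4 * b * B = 4 * b * B * (1 - α * j) := by
      linear_combination (8 * b ^ 2 * x ^ 2 : ℂ) * hIσ
    rw [hE]
    have hne : (1 - α * j : ℂ) ≠ 0 := by
      intro h0
      have h1 : (1 : ℂ) + α ^ 2 = 0 := by
        linear_combination (1 + α * j) * h0 + (α ^ 2 : ℂ) * hIσ
      rw [h1, mul_zero] at hbC
      exact zero_ne_one hbC
    have hb0C : (b : ℂ) ≠ 0 := by exact_mod_cast hb0
    exact mul_ne_zero (mul_ne_zero (mul_ne_zero (by norm_num) hb0C) hB0) hne
end

section
/- Let α > 0, β > 0, μ < 0, c_cp ∈ (−1,1), β⁻ = β/(1−c_cp), and h > β⁻/α − μ. Set s_lin = 2·√((h + μ − β⁻/α)/(1+α²)) and Ω_lin = (2h + 2μ + αβ⁻ − β⁻/α)/(1+α²). Then, with s = s_lin and Ω = Ω_lin, both double roots of d⁻ satisfy λ_dr^+ = λ_dr^− = 0, and the quartic ν ↦ d⁻(0, ν) factors as d⁻(0,ν) = (1/(1+α²))·(ν + α·s_lin/2 − i·s_lin/2)²·(ν + α·s_lin/2 + i·s_lin/2)² for all ν ∈ ℂ; i.e., the spatial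 roots at λ = 0 form a doubled double root corresponding to the translation and rotation symmetries. -/
/-- At `s = s_lin` and `Ω = Ω_lin`, both double roots `λ_dr^±` of `d⁻`
vanish, and the quartic `ν ↦ d⁻(0,ν)` factors as
`(1/(1+α²))·(ν + αs_lin/2 − i s_lin/2)²·(ν + αs_lin/2 + i s_lin/2)²`:
a doubled double root corresponding to translation and rotation symmetries. -/
theorem stmt15 (α β ccp μ h : ℝ) (hα : 0 < α) (hβ : 0 < β) (hμ : μ < 0)
    (hc1 : -1 < ccp) (hc2 : ccp < 1) (hmono : β / (1 - ccp) / α - μ < h)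
    (slin Ωlin : ℝ)
    (hslin : slin = 2 * Real.sqrt ((h + μ - β / (1 - ccp) / α) / (1 + α ^ 2)))
    (hΩlin : Ωlin = (2 * h + 2 * μ + α * (β / (1 - ccp)) - β / (1 - ccp) / α) / (1 + α ^ 2)) :
    (((-α * slin ^ 2 / 4 + (α * (h + μ) - β / (1 - ccp)) / (1 + α ^ 2) : ℝ) : ℂ)
        + Complex.I * ((slin ^ 2 / 4 + (h + μ + α * (β / (1 - ccp))) / (1 + α ^ 2) - Ωlin : ℝ) : ℂ)
      = 0) ∧
    (((-α * slin ^ 2 / 4 + (α * (h + μ) - β / (1 - ccp)) / (1 + α ^ 2) : ℝ) : ℂ)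
        - Complex.I * ((slin ^ 2 / 4 + (h + μ + α * (β / (1 - ccp))) / (1 + α ^ 2) - Ωlin : ℝ) : ℂ)
      = 0) ∧
    ∀ ν : ℂ, dMinus α β ccp μ h slin Ωlin 0 ν
      = ((1 / (1 + α ^ 2) : ℝ) : ℂ)
        * (ν + ((α * slin / 2 : ℝ) : ℂ) - Complex.I * ((slin / 2 : ℝ) : ℂ)) ^ 2
        * (ν + ((α * slin / 2 : ℝ) : ℂ) + Complex.I * ((slin / 2 : ℝ) : ℂ)) ^ 2 := by
  have hA : 1 + α ^ 2 ≠ 0 := by positivity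
  have hα' : α ≠ 0 := hα.ne'
  have hpos : 0 ≤ (h + μ - β / (1 - ccp) / α) / (1 + α ^ 2) :=
    div_nonneg (by linarith) (by positivity)
  have hsq : slin ^ 2 / 4 = (h + μ - β / (1 - ccp) / α) / (1 + α ^ 2) := by
    rw [hslin, mul_pow, Real.sq_sqrt hpos]
    ring
  unfold dMinus
  generalize β / (1 - ccp) = B at *
  have hre : (α * (h + μ) - B) / (1 + α ^ 2) = α * slin ^ 2 / 4 := by
    rw [mul_div_assoc, hsq]
    field_simp
  have him : (h + μ + α * B) / (1 + α ^ 2) - Ωlin = -(slin ^ 2 / 4) := by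
    rw [hsq, hΩlin]
    field_simp
    ring
  have hre0 : -α * slin ^ 2 / 4 + (α * (h + μ) - B) / (1 + α ^ 2) = 0 := by
    rw [hre]
    ring
  have him0 : slin ^ 2 / 4 + (h + μ + α * B) / (1 + α ^ 2) - Ωlin = 0 := by
    linarith
  refine ⟨by rw [hre0, him0]; simp, by rw [hre0, him0]; simp, fun ν => ?_⟩
  have hAC : (1 + (α : ℂ) ^ 2) ≠ 0 := by exact_mod_cast hA
  have hfactor : (ν + ((α * slin / 2 : ℝ) : ℂ) - Complex.I * ((slin / 2 : ℝ) : ℂ))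
      * (ν + ((α * slin / 2 : ℝ) : ℂ) + Complex.I * ((slin / 2 : ℝ) : ℂ))
      = ν ^ 2 + α * slin * ν + (1 + (α : ℂ) ^ 2) * slin ^ 2 / 4 := by
    push_cast
    linear_combination (-(slin : ℂ) ^ 2 / 4) * Complex.I_sq
  rw [mul_assoc, ← mul_pow, hfactor, hre, him]
  push_cast
  field_simp
  ring
end

section
/- Let α > 0, β ≥ 0, μ < 0 and h ∈ ℝ. Then the speed of the explicit homogeneous domain wall, given by s_hom(h)² = (αh − β)²/(−μ(1+α²)²), equals the linear spreading speed, given by s_lin(h)² = 4(h + μ − β/α)/(1+α²), if and only if h = h^s_+ or h = h^s_−, where h^s_± = β/α − 2μ − 2μ/α² ± (2μ/α²)·√(1+α²). Moreover β/α − μ < h^s_+ < β/α − 2μ < h^s_−. -/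
/-- For `α > 0`, `β ≥ 0`, `μ < 0`, the squared speed of the explicit
homogeneous domain wall, `(αh − β)²/(−μ(1+α²)²)`, equals the squared linear spreading
speed `4(h + μ − β/α)/(1+α²)` if and only if `h = h^s_+` or `h = h^s_−`, where
`h^s_± = β/α − 2μ − 2μ/α² ± (2μ/α²)√(1+α²)`; moreover
`β/α − μ < h^s_+ < β/α − 2μ < h^s_−`. -/
theorem stmt16 (α β μ h : ℝ) (hα : 0 < α) (hβ : 0 ≤ β) (hμ : μ < 0)
    (hsp hsm : ℝ)
    (hhsp : hsp = β / α - 2 * μ - 2 * μ / α ^ 2 + (2 * μ / α ^ 2) * Real.sqrt (1 + α ^ 2))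
    (hhsm : hsm = β / α - 2 * μ - 2 * μ / α ^ 2 - (2 * μ / α ^ 2) * Real.sqrt (1 + α ^ 2)) :
    ((α * h - β) ^ 2 / (-μ * (1 + α ^ 2) ^ 2) = 4 * (h + μ - β / α) / (1 + α ^ 2)
      ↔ h = hsp ∨ h = hsm) ∧
    β / α - μ < hsp ∧ hsp < β / α - 2 * μ ∧ β / α - 2 * μ < hsm := by
  obtain ⟨S, hS⟩ : ∃ S, S = Real.sqrt (1 + α ^ 2) := ⟨_, rfl⟩
  obtain ⟨r, hr⟩ : ∃ r, r = β / α := ⟨_, rfl⟩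
  obtain ⟨k, hk⟩ : ∃ k, k = -μ / α ^ 2 := ⟨_, rfl⟩
  have hα2 : 0 < α ^ 2 := by positivity
  have hk0 : 0 < k := hk ▸ div_pos (neg_pos.mpr hμ) hα2
  have hS2 : S ^ 2 = 1 + α ^ 2 := hS ▸ Real.sq_sqrt (by positivity)
  have hS1 : 1 < S := by
    have : 0 ≤ S := hS ▸ Real.sqrt_nonneg _
    nlinarith
  have hβr : β = r * α := by rw [hr]; field_simp
  have hμk : μ = -(k * α ^ 2) := by rw [hk]; field_simp
  have hdiv : 2 * μ / α ^ 2 = -2 * k := by rw [hμk]; field_simp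
  rw [← hr, hdiv, ← hS] at hhsp hhsm
  have hsp_eq : hsp = r + 2 * k * S ^ 2 - 2 * k * S := by
    rw [hhsp, hS2, hμk]; ring
  have hsm_eq : hsm = r + 2 * k * S ^ 2 + 2 * k * S := by
    rw [hhsm, hS2, hμk]; ring
  have hμS : μ = -(k * (S ^ 2 - 1)) := by rw [hμk, hS2]; ring
  rw [← hr]
  refine ⟨?_, ?_, ?_, ?_⟩
  · have hfactor : (α * h - β) ^ 2 * (1 + α ^ 2)
          - 4 * (h + μ - r) * (-μ * (1 + α ^ 2) ^ 2)
        = α ^ 2 * (1 + α ^ 2) * ((h - hsp) * (h - hsm)) := by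
      have hα2S : α ^ 2 = S ^ 2 - 1 := by rw [hS2]; ring
      have hsq : (α * h - β) ^ 2 = α ^ 2 * (h - r) ^ 2 := by rw [hβr]; ring
      rw [hsq, hsp_eq, hsm_eq, hμS, hα2S]
      ring
    have hne : α ^ 2 * (1 + α ^ 2) ≠ 0 := by positivity
    have hden : -μ * (1 + α ^ 2) ^ 2 ≠ 0 :=
      mul_ne_zero (neg_ne_zero.mpr hμ.ne) (by positivity)
    rw [div_eq_div_iff hden (by positivity), ← sub_eq_zero, hfactor,
      mul_eq_zero_iff_left hne, mul_eq_zero, sub_eq_zero, sub_eq_zero]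
  · have : 0 < k * (S - 1) ^ 2 := mul_pos hk0 (pow_pos (sub_pos.mpr hS1) 2)
    rw [hsp_eq, hμS]
    linarith
  · have : 0 < k * (S - 1) := mul_pos hk0 (sub_pos.mpr hS1)
    rw [hsp_eq, hμS]
    linarith
  · have : 0 < k * (S + 1) := mul_pos hk0 (by linarith)
    rw [hsm_eq, hμS]
    linarith
end
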